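/- (Theorem 6: high-SNR OPRA capacity in closed form.) For all real parameters m > 0, γ̄ > 0, γ₀ > 0 and 0 < k < m: ∫₀^∞ log₂(γ/γ₀) · f(γ) dγ = log₂(γ̄/(γ₀(k+1))) − γ_E/ln 2 + (Γ(m+1)/ln 2) · ∑_{i=0}^∞ ((m)_i / i!) · (k/m)^i · (H_i − γ_E) · U(m+i, i, k/m). -/

import Mathlib

open MeasureTheory Set

/-- Pochhammer symbol (rising factorial) `(m)_i = m(m+1)⋯(m+i−1)`. -/
noncomputable def poch (m : ℝ) (i : ℕ) : ℝ := ∏ j ∈ Finset.range i, (m + j)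

/-- `n`-th harmonic number `H_n = ∑_{j=1}^n 1/j` (with `H_0 = 0`). -/
noncomputable def harmonicR (n : ℕ) : ℝ := ∑ j ∈ Finset.range n, 1 / ((j : ℝ) + 1)

/-- Kummer confluent hypergeometric function `₁F₁(m, 1, z) = ∑_{i=0}^∞ ((m)_i/(i!)²) z^i`. -/
noncomputable def kummerM (m z : ℝ) : ℝ :=
  ∑' i : ℕ, poch m i / ((Nat.factorial i : ℝ) ^ 2) * z ^ i

/-- Kummer confluent hypergeometric function of the second kind
`U(a, b, z) = (1/Γ(a)) ∫₀^∞ e^{−zt} t^{a−1} (1+t)^{b−a−1} dt`. -/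
noncomputable def kummerU (a b z : ℝ) : ℝ :=
  (1 / Real.Gamma a) *
    ∫ t in Ioi (0 : ℝ), Real.exp (-z * t) * t ^ (a - 1) * (1 + t) ^ (b - a - 1)

/-- Conditional SNR density of the fdRLoS channel,
`f(γ|x)` with `k_x = k/x`, `γ̄_x = ((k+x)/(k+1))·γ̄`. -/
noncomputable def condPdf (m k γb x γ : ℝ) : ℝ :=
  (m ^ m * (1 + k / x)) / ((m + k / x) ^ m * ((k + x) / (k + 1) * γb)) *
    Real.exp (-((1 + k / x) / ((k + x) / (k + 1) * γb)) * γ) *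
    kummerM m ((k / x) * (1 + k / x) / (k / x + m) * (γ / ((k + x) / (k + 1) * γb)))

/-- Unconditional SNR density of the fdRLoS channel, `f(γ) = ∫₀^∞ f(γ|x) e^{−x} dx`. -/
noncomputable def pdfSNR (m k γb γ : ℝ) : ℝ :=
  ∫ x in Ioi (0 : ℝ), condPdf m k γb x γ * Real.exp (-x)


/-! ### General facts -/

/-- The sum of a series of integrable functions with summable `L¹` norms is integrable. -/
lemma integrable_tsum_of_summable {α : Type*} [MeasurableSpace α] {μ : Measure α}
    {F : ℕ → α → ℝ} (hF : ∀ i, Integrable (F i) μ)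
    (hs : Summable fun i => ∫ a, ‖F i a‖ ∂μ) :
    Integrable (fun a => ∑' i, F i a) μ := by
  have hfin : ∑' i, ∫⁻ a, ‖F i a‖ₑ ∂μ ≠ ⊤ := by
    have h1 : ∀ i, ∫⁻ a, ‖F i a‖ₑ ∂μ = ENNReal.ofReal (∫ a, ‖F i a‖ ∂μ) := fun i =>
      (ofReal_integral_norm_eq_lintegral_enorm (hF i)).symm
    rw [funext h1]
    exact hs.tsum_ofReal_ne_top
  have hm : ∀ i, AEMeasurable (fun a => ‖F i a‖ₑ) μ := fun i => (hF i).1.enorm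
  rw [← lintegral_tsum hm] at hfin
  have hae : ∀ᵐ a ∂μ, Summable fun i => F i a := by
    filter_upwards [ae_lt_top' (AEMeasurable.tsum hm) hfin] with a ha
    have : Summable fun i => ‖F i a‖₊ := ENNReal.tsum_coe_ne_top_iff_summable.1 ha.ne
    exact Summable.of_nnnorm this
  refine ⟨?_, ?_⟩
  · refine aestronglyMeasurable_of_tendsto_ae Filter.atTop
      (f := fun n a => ∑ i ∈ Finset.range n, F i a) (fun n => ?_) ?_
    · exact (integrable_finsetSum _ fun i _ => hF i).1
    · filter_upwards [hae] with a ha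
      exact ha.hasSum.tendsto_sum_nat
  · refine lt_of_le_of_lt (lintegral_mono fun a => ?_) (lt_top_iff_ne_top.2 hfin)
    exact enorm_tsum_le_tsum_enorm

/-- `∫₀^∞ log t · tⁿ e^{-t} dt = n! (H_n - γ_E)`. -/
lemma integral_log_mul_pow_exp (n : ℕ) :
    ∫ t in Ioi (0 : ℝ), t ^ n * (Real.log t * Real.exp (-t)) =
      (n.factorial : ℝ) * (harmonicR n - Real.eulerMascheroniConstant) := by
  have hs : (0 : ℝ) < ((n : ℂ) + 1).re := by simp; positivity
  have h1 := Complex.hasDerivAt_GammaIntegral hs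
  have h2 : HasDerivAt Complex.Gamma
      (∫ t : ℝ in Ioi 0, (t : ℂ) ^ ((n : ℂ) + 1 - 1) * (Real.log t * Real.exp (-t)))
      ((n : ℂ) + 1) := by
    refine h1.congr_of_eventuallyEq ?_
    have : ∀ᶠ s : ℂ in nhds ((n : ℂ) + 1), 0 < s.re :=
      (Complex.continuous_re.isOpen_preimage _ isOpen_Ioi).mem_nhds hs
    filter_upwards [this] with s hs
    exact Complex.Gamma_eq_integral hs
  have h3 := h2.deriv
  rw [Complex.deriv_Gamma_nat] at h3
  have h4 : (∫ t : ℝ in Ioi 0, (t : ℂ) ^ ((n : ℂ) + 1 - 1) * (Real.log t * Real.exp (-t)))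
      = ((∫ t in Ioi (0 : ℝ), t ^ n * (Real.log t * Real.exp (-t)) : ℝ) : ℂ) := by
    refine Eq.trans ?_ integral_ofReal
    refine setIntegral_congr_fun measurableSet_Ioi fun t ht => ?_
    simp
  rw [h4] at h3
  have h5 : (harmonicR n : ℝ) = (harmonic n : ℝ) := by
    simp [harmonicR, harmonic]
  rw [h5]
  have h6 : (((n.factorial : ℝ) * (-Real.eulerMascheroniConstant + (harmonic n : ℝ)) : ℝ) : ℂ)
      = ((∫ t in Ioi (0 : ℝ), t ^ n * (Real.log t * Real.exp (-t)) : ℝ) : ℂ) := by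
    rw [← h3]; push_cast; ring
  have h7 := Complex.ofReal_injective h6
  rw [← h7]; ring

lemma poch_succ (m : ℝ) (i : ℕ) : poch m (i + 1) = poch m i * (m + i) := by
  simp [poch, Finset.prod_range_succ]

lemma poch_succ' (m : ℝ) (i : ℕ) : poch m (i + 1) = m * poch (m + 1) i := by
  simp only [poch, Finset.prod_range_succ']
  rw [mul_comm]
  congr 1
  · simp
  · refine Finset.prod_congr rfl fun j _ => ?_
    push_cast; ring

lemma poch_nonneg {m : ℝ} (hm : 0 < m) (i : ℕ) : 0 ≤ poch m i :=
  Finset.prod_nonneg fun j _ => by positivity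

lemma choose_eq_poch (m : ℝ) (i : ℕ) :
    Ring.choose (m + i - 1) i = poch m i / (i.factorial : ℝ) := by
  rw [← Ring.multichoose_eq]
  have h := Ring.factorial_nsmul_multichoose_eq_ascPochhammer m i
  rw [Polynomial.ascPochhammer_smeval_eq_eval] at h
  have h2 : ∀ j : ℕ, (ascPochhammer ℝ j).eval m = poch m j := by
    intro j
    induction j with
    | zero => simp [poch]
    | succ j ih => rw [ascPochhammer_succ_eval, ih, poch_succ]
  rw [h2, nsmul_eq_mul] at h
  rw [← h]
  field_simp

/-- The negative binomial series. -/
lemma hasSum_negBinomial (m q : ℝ) (hq0 : 0 ≤ q) (hq : q < 1) :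
    HasSum (fun i : ℕ => poch m i / (i.factorial : ℝ) * q ^ i) (1 / (1 - q) ^ m) := by
  have h := (Real.one_div_one_sub_rpow_hasFPowerSeriesOnBall_zero m).hasSum (y := q) (by
    simp only [Metric.mem_eball, edist_zero_right]
    rw [← ofReal_norm, Real.norm_of_nonneg hq0]
    exact ENNReal.ofReal_lt_one.2 hq)
  simp only [zero_add] at h
  have h2 : (fun i : ℕ => poch m i / (i.factorial : ℝ) * q ^ i) = fun n : ℕ =>
      (FormalMultilinearSeries.ofScalars ℝ (fun n : ℕ => Ring.choose (m + n - 1) n) n)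
        fun _ => q := by
    ext i
    rw [← choose_eq_poch]
    simp [mul_comm]
  rw [h2]
  exact h

/-- Negative-binomial weights of the conditional density. -/
noncomputable def wgt (m z : ℝ) (i : ℕ) (x : ℝ) : ℝ :=
  x ^ m * z ^ i * poch m i / (i.factorial : ℝ) / (x + z) ^ (m + i)

lemma wgt_nonneg {m z x : ℝ} (hm : 0 < m) (hz : 0 < z) (hx : 0 < x) (i : ℕ) :
    0 ≤ wgt m z i x := by
  have := poch_nonneg hm i
  unfold wgt; positivity

lemma hasSum_wgt {m z x : ℝ} (hz : 0 < z) (hx : 0 < x) :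
    HasSum (fun i => wgt m z i x) 1 := by
  have hxz : 0 < x + z := by positivity
  have h := (hasSum_negBinomial m (z / (x + z)) (by positivity)
    (by rw [div_lt_one hxz]; linarith)).mul_left (x ^ m / (x + z) ^ m)
  have h1 : 1 - z / (x + z) = x / (x + z) := by field_simp; ring
  rw [h1, Real.div_rpow hx.le hxz.le] at h
  have hxm : 0 < x ^ m := by positivity
  have hxzm : 0 < (x + z) ^ m := by positivity
  have h2 : x ^ m / (x + z) ^ m * (1 / (x ^ m / (x + z) ^ m)) = 1 := by field_simp
  rw [h2] at h
  have h3 : (fun i => wgt m z i x) = fun i : ℕ =>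
      x ^ m / (x + z) ^ m * (poch m i / (i.factorial : ℝ) * (z / (x + z)) ^ i) := by
    ext i
    rw [wgt, Real.rpow_add hxz, Real.rpow_natCast, div_pow]
    field_simp
  rw [h3]
  exact h

lemma wgt_le_one {m z x : ℝ} (hm : 0 < m) (hz : 0 < z) (hx : 0 < x) (i : ℕ) :
    wgt m z i x ≤ 1 :=
  le_hasSum (hasSum_wgt hz hx) i fun j _ => wgt_nonneg hm hz hx j

lemma measurable_wgt (m z : ℝ) (i : ℕ) : Measurable (wgt m z i) := by
  unfold wgt; fun_prop

lemma mul_wgt_succ {m z x : ℝ} (hx : 0 < x) (i : ℕ) :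
    x * ((i + 1 : ℕ) * wgt m z (i + 1) x) = m * z * wgt (m + 1) z i x := by
  rw [wgt, wgt, poch_succ', Real.rpow_add hx, Nat.factorial_succ]
  have : m + ((i + 1 : ℕ) : ℝ) = m + 1 + i := by push_cast; ring
  rw [this]
  push_cast
  rw [Real.rpow_one, pow_succ]
  field_simp

lemma integrable_mul_wgt {m z : ℝ} (hm : 0 < m) (hz : 0 < z) {h : ℝ → ℝ}
    (hh : IntegrableOn h (Ioi 0)) (i : ℕ) :
    IntegrableOn (fun x => h x * wgt m z i x) (Ioi 0) := by
  refine Integrable.mono hh (hh.1.mul (measurable_wgt m z i).aestronglyMeasurable) ?_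
  refine (ae_restrict_iff' measurableSet_Ioi).2 (Filter.Eventually.of_forall fun x hx => ?_)
  rw [norm_mul, Real.norm_of_nonneg (wgt_nonneg hm hz hx i)]
  exact mul_le_of_le_one_right (norm_nonneg _) (wgt_le_one hm hz hx i)

lemma summable_integral_norm_mul_wgt {m z : ℝ} (hm : 0 < m) (hz : 0 < z) {h : ℝ → ℝ}
    (hh : IntegrableOn h (Ioi 0)) :
    Summable fun i => ∫ x in Ioi (0 : ℝ), ‖h x * wgt m z i x‖ := by
  refine summable_of_sum_le (c := ∫ x in Ioi (0 : ℝ), ‖h x‖)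
    (fun i => integral_nonneg fun x => norm_nonneg _) fun s => ?_
  rw [← integral_finsetSum _ fun i _ => (integrable_mul_wgt hm hz hh i).norm]
  refine setIntegral_mono_on (integrable_finsetSum _ fun i _ =>
    (integrable_mul_wgt hm hz hh i).norm) hh.norm measurableSet_Ioi fun x hx => ?_
  have : ∀ i, ‖h x * wgt m z i x‖ = ‖h x‖ * wgt m z i x := fun i => by
    rw [norm_mul, Real.norm_of_nonneg (wgt_nonneg hm hz hx i)]
  simp only [this]
  rw [← Finset.mul_sum]
  exact mul_le_of_le_one_right (norm_nonneg _)
    (sum_le_hasSum (f := fun i => wgt m z i x) (a := 1) s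
      (fun j _ => wgt_nonneg hm hz hx j) (hasSum_wgt (m := m) hz hx))

lemma hasSum_integral_mul_wgt {m z : ℝ} (hm : 0 < m) (hz : 0 < z) {h : ℝ → ℝ}
    (hh : IntegrableOn h (Ioi 0)) :
    HasSum (fun i => ∫ x in Ioi (0 : ℝ), h x * wgt m z i x) (∫ x in Ioi (0 : ℝ), h x) := by
  have := hasSum_integral_of_summable_integral_norm (integrable_mul_wgt hm hz hh)
    (summable_integral_norm_mul_wgt hm hz hh)
  have e : ∫ x in Ioi (0 : ℝ), ∑' i, h x * wgt m z i x = ∫ x in Ioi (0 : ℝ), h x := by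
    refine setIntegral_congr_fun measurableSet_Ioi fun x hx => ?_
    simp only [tsum_mul_left]
    rw [(hasSum_wgt hz hx).tsum_eq, mul_one]
  rwa [e] at this

/-! ### Gamma (Erlang) kernel -/

/-- Erlang density with shape `i + 1` and rate `r`. -/
noncomputable def pk (i : ℕ) (r γ : ℝ) : ℝ :=
  r ^ (i + 1) * γ ^ i / (i.factorial : ℝ) * Real.exp (-(r * γ))

lemma pk_nonneg {i : ℕ} {r γ : ℝ} (hr : 0 < r) (hγ : 0 < γ) : 0 ≤ pk i r γ := by
  unfold pk; positivity

lemma integrableOn_rpow_mul_exp {a r : ℝ} (ha : 0 < a) (hr : 0 < r) :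
    IntegrableOn (fun t : ℝ => t ^ (a - 1) * Real.exp (-(r * t))) (Ioi 0) := by
  have h := integrableOn_rpow_mul_exp_neg_mul_rpow (p := 1) (s := a - 1) (b := r)
    (by linarith) one_pos hr
  simpa using h

lemma rpow_mul_pk {i : ℕ} {r γ : ℝ} (s : ℝ) (hγ : 0 < γ) :
    γ ^ s * pk i r γ = r ^ (i + 1) / (i.factorial : ℝ) *
      (γ ^ ((i + 1 + s) - 1) * Real.exp (-(r * γ))) := by
  have : (i : ℝ) + 1 + s - 1 = i + s := by ring
  rw [pk, this, Real.rpow_add hγ, Real.rpow_natCast]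
  ring

lemma integrableOn_rpow_mul_pk {i : ℕ} {r s : ℝ} (hr : 0 < r) (hs : -1 < s) :
    IntegrableOn (fun γ => γ ^ s * pk i r γ) (Ioi 0) := by
  have hi : 0 < (i : ℝ) + 1 + s := by have := Nat.cast_nonneg (α := ℝ) i; linarith
  refine IntegrableOn.congr_fun ((integrableOn_rpow_mul_exp hi hr).const_mul
    (r ^ (i + 1) / (i.factorial : ℝ))) (fun γ hγ => ?_) measurableSet_Ioi
  exact (rpow_mul_pk s hγ).symm

lemma integral_rpow_mul_pk {i : ℕ} {r s : ℝ} (hr : 0 < r) (hs : -1 < s) :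
    ∫ γ in Ioi (0 : ℝ), γ ^ s * pk i r γ =
      r ^ (-s) * Real.Gamma (i + 1 + s) / (i.factorial : ℝ) := by
  have hi : 0 < (i : ℝ) + 1 + s := by have := Nat.cast_nonneg (α := ℝ) i; linarith
  rw [setIntegral_congr_fun measurableSet_Ioi (fun γ hγ => rpow_mul_pk s hγ),
    integral_const_mul, Real.integral_rpow_mul_exp_neg_mul_Ioi hi hr]
  have h1 : r ^ (i + 1) = r ^ ((i : ℝ) + 1) := by
    rw [← Real.rpow_natCast]; push_cast; rfl
  have h2 : r ^ (-s) = r ^ ((i : ℝ) + 1) * (1 / r) ^ ((i : ℝ) + 1 + s) := by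
    rw [one_div, Real.inv_rpow hr.le, ← Real.rpow_neg hr.le, ← Real.rpow_add hr]
    congr 1; ring
  rw [h1, h2]
  ring

lemma integrableOn_pk {i : ℕ} {r : ℝ} (hr : 0 < r) :
    IntegrableOn (fun γ => pk i r γ) (Ioi 0) := by
  simpa using integrableOn_rpow_mul_pk (i := i) (s := 0) hr (by norm_num)

lemma integral_pk {i : ℕ} {r : ℝ} (hr : 0 < r) :
    ∫ γ in Ioi (0 : ℝ), pk i r γ = 1 := by
  have h := integral_rpow_mul_pk (i := i) (s := 0) hr (by norm_num)
  simp only [Real.rpow_zero, one_mul, neg_zero, add_zero, Real.Gamma_nat_eq_factorial] at h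
  rw [h]
  field_simp

lemma integral_mul_pk {i : ℕ} {r : ℝ} (hr : 0 < r) :
    ∫ γ in Ioi (0 : ℝ), γ ^ (1 : ℝ) * pk i r γ = (i + 1) / r := by
  rw [integral_rpow_mul_pk hr (by norm_num), Real.Gamma_add_one (by positivity),
    Real.Gamma_nat_eq_factorial, Real.rpow_neg_one]
  field_simp

lemma Gamma_half_le (i : ℕ) :
    Real.Gamma (i + 1 + (-(1 / 2))) ≤ Real.Gamma (1 / 2) * (i.factorial : ℝ) := by
  induction i with
  | zero => norm_num
  | succ i ih =>
    have h1 : ((i + 1 : ℕ) : ℝ) + 1 + (-(1 / 2)) = (i + 1 + (-(1 / 2)) : ℝ) + 1 := by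
      push_cast; ring
    have h2 : (0 : ℝ) < i + 1 + (-(1 / 2)) := by
      have := Nat.cast_nonneg (α := ℝ) i; linarith
    have h3 : 0 ≤ Real.Gamma (1 / 2) * (i.factorial : ℝ) := by
      have : 0 < Real.Gamma (1 / 2) := Real.Gamma_pos_of_pos (by norm_num)
      positivity
    rw [h1, Real.Gamma_add_one h2.ne', Nat.factorial_succ]
    push_cast
    calc _ ≤ ((i : ℝ) + 1) * (Real.Gamma (1 / 2) * (i.factorial : ℝ)) :=
          mul_le_mul (by linarith) ih (Real.Gamma_pos_of_pos h2).le (by positivity)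
      _ = _ := by ring

lemma integral_rpow_half_mul_pk_le {i : ℕ} {r : ℝ} (hr : 0 < r) :
    ∫ γ in Ioi (0 : ℝ), γ ^ (-(1 / 2) : ℝ) * pk i r γ ≤
      r ^ (1 / 2 : ℝ) * Real.Gamma (1 / 2) := by
  rw [integral_rpow_mul_pk hr (by norm_num), neg_neg,
    div_le_iff₀ (by positivity : (0 : ℝ) < i.factorial), mul_assoc]
  exact mul_le_mul_of_nonneg_left (Gamma_half_le i) (by positivity)

lemma abs_log_le {t : ℝ} (ht : 0 < t) :
    |Real.log t| ≤ t ^ (1 : ℝ) + 2 * t ^ (-(1 / 2) : ℝ) := by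
  have h1 := Real.log_le_sub_one_of_pos ht
  have hp : 0 < t ^ (-(1 / 2) : ℝ) := by positivity
  have h2 := Real.log_le_sub_one_of_pos hp
  rw [Real.log_rpow ht] at h2
  rw [Real.rpow_one, abs_le]
  constructor <;> linarith

lemma abs_log_div_le {t a : ℝ} (ht : 0 < t) (ha : 0 < a) :
    |Real.log (t / a)| ≤ t ^ (1 : ℝ) + 2 * t ^ (-(1 / 2) : ℝ) + |Real.log a| := by
  rw [Real.log_div ht.ne' ha.ne']
  exact (abs_sub _ _).trans (by linarith [abs_log_le ht])

lemma measurable_pk (i : ℕ) (r : ℝ) : Measurable (pk i r) := by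
  unfold pk; fun_prop

/-- Integrable majorant. -/
lemma integrableOn_major_pk {i : ℕ} {r : ℝ} (A : ℝ) (hr : 0 < r) :
    IntegrableOn (fun γ => (γ ^ (1 : ℝ) + 2 * γ ^ (-(1 / 2) : ℝ) + A) * pk i r γ) (Ioi 0) := by
  have h1 := integrableOn_rpow_mul_pk (i := i) (s := 1) hr (by norm_num)
  have h2 := (integrableOn_rpow_mul_pk (i := i) (s := -(1 / 2)) hr (by norm_num)).const_mul 2
  have h3 := (integrableOn_pk (i := i) hr).const_mul A
  refine IntegrableOn.congr_fun ((h1.add h2).add h3) (fun γ _ => ?_) measurableSet_Ioi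
  simp only [Pi.add_apply]
  ring

lemma integral_major_pk_le {i : ℕ} {r : ℝ} (A : ℝ) (hr : 0 < r) :
    ∫ γ in Ioi (0 : ℝ), (γ ^ (1 : ℝ) + 2 * γ ^ (-(1 / 2) : ℝ) + A) * pk i r γ ≤
      (i + 1) / r + 2 * (r ^ (1 / 2 : ℝ) * Real.Gamma (1 / 2)) + A := by
  have h1 := integrableOn_rpow_mul_pk (i := i) (s := 1) hr (by norm_num)
  have h2 := (integrableOn_rpow_mul_pk (i := i) (s := -(1 / 2)) hr (by norm_num)).const_mul 2
  have h3 := (integrableOn_pk (i := i) hr).const_mul A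
  have e : ∫ γ in Ioi (0 : ℝ), (γ ^ (1 : ℝ) + 2 * γ ^ (-(1 / 2) : ℝ) + A) * pk i r γ =
      (∫ γ in Ioi (0 : ℝ), γ ^ (1 : ℝ) * pk i r γ) +
      2 * (∫ γ in Ioi (0 : ℝ), γ ^ (-(1 / 2) : ℝ) * pk i r γ) +
      A * ∫ γ in Ioi (0 : ℝ), pk i r γ := by
    rw [← integral_const_mul, ← integral_const_mul, ← integral_add h1 h2,
      ← integral_add (f := fun γ => γ ^ (1 : ℝ) * pk i r γ + 2 * (γ ^ (-(1 / 2) : ℝ) * pk i r γ))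
        (h1.add h2) h3]
    refine setIntegral_congr_fun measurableSet_Ioi fun γ _ => ?_
    ring
  rw [e, integral_mul_pk hr, integral_pk hr]
  have := integral_rpow_half_mul_pk_le (i := i) hr
  linarith

lemma integrableOn_log_mul_pk {i : ℕ} {r a : ℝ} (hr : 0 < r) (ha : 0 < a) :
    IntegrableOn (fun γ => Real.log (γ / a) * pk i r γ) (Ioi 0) := by
  refine Integrable.mono' (integrableOn_major_pk (i := i) |Real.log a| hr) ?_ ?_
  · have := measurable_pk i r
    exact Measurable.aestronglyMeasurable (by fun_prop)
  · refine (ae_restrict_iff' measurableSet_Ioi).2 (Filter.Eventually.of_forall fun x hx => ?_)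
    rw [norm_mul, Real.norm_of_nonneg (pk_nonneg hr hx)]
    exact mul_le_mul_of_nonneg_right (abs_log_div_le hx ha) (pk_nonneg hr hx)

lemma integral_abs_log_mul_pk_le {i : ℕ} {r a : ℝ} (hr : 0 < r) (ha : 0 < a) :
    ∫ γ in Ioi (0 : ℝ), |Real.log (γ / a)| * pk i r γ ≤
      (i + 1) / r + 2 * (r ^ (1 / 2 : ℝ) * Real.Gamma (1 / 2)) + |Real.log a| := by
  refine le_trans ?_ (integral_major_pk_le _ hr)
  refine setIntegral_mono_on ?_ (integrableOn_major_pk _ hr) measurableSet_Ioi fun x hx =>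
    mul_le_mul_of_nonneg_right (abs_log_div_le hx ha) (pk_nonneg hr hx)
  refine IntegrableOn.congr_fun (integrableOn_log_mul_pk (i := i) hr ha).norm
    (fun x hx => ?_) measurableSet_Ioi
  rw [norm_mul, Real.norm_of_nonneg (pk_nonneg hr hx), Real.norm_eq_abs]

lemma integral_log_mul_pk {i : ℕ} {r a : ℝ} (hr : 0 < r) (ha : 0 < a) :
    ∫ γ in Ioi (0 : ℝ), Real.log (γ / a) * pk i r γ =
      harmonicR i - Real.eulerMascheroniConstant - Real.log r - Real.log a := by
  have key := integral_comp_mul_left_Ioi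
    (fun t => Real.log (t / (r * a)) * pk i 1 t) 0 hr
  have h1 : ∀ γ ∈ Ioi (0 : ℝ), Real.log (γ / a) * pk i r γ =
      r * (Real.log (r * γ / (r * a)) * pk i 1 (r * γ)) := by
    intro γ _
    rw [mul_div_mul_left _ _ hr.ne']
    simp only [pk]
    rw [mul_pow, pow_succ]
    simp only [one_pow, one_mul]
    ring
  rw [setIntegral_congr_fun measurableSet_Ioi h1, integral_const_mul, key, mul_zero, smul_eq_mul,
    ← mul_assoc, mul_inv_cancel₀ hr.ne', one_mul]
  have h2 : ∀ t ∈ Ioi (0 : ℝ), Real.log (t / (r * a)) * pk i 1 t =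
      Real.log (t / 1) * pk i 1 t - Real.log (r * a) * pk i 1 t := by
    intro t ht
    rw [Real.log_div (ne_of_gt ht) (by positivity), div_one]
    ring
  rw [setIntegral_congr_fun measurableSet_Ioi h2,
    integral_sub (integrableOn_log_mul_pk one_pos one_pos)
      ((integrableOn_pk one_pos).const_mul _), integral_const_mul, integral_pk one_pos,
    Real.log_mul hr.ne' ha.ne']
  have h3 : ∀ t ∈ Ioi (0 : ℝ), Real.log (t / 1) * pk i 1 t =
      (1 / (i.factorial : ℝ)) * (t ^ i * (Real.log t * Real.exp (-t))) := by
    intro t _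
    simp only [pk, div_one, one_pow, one_mul]
    ring
  rw [setIntegral_congr_fun measurableSet_Ioi h3, integral_const_mul, integral_log_mul_pow_exp]
  field_simp
  ring

/-! ### Kummer's function `U` -/

lemma poch_pos {m : ℝ} (hm : 0 < m) (i : ℕ) : 0 < poch m i :=
  Finset.prod_pos fun j _ => by positivity

lemma integrableOn_exp_neg_pk : IntegrableOn (fun x : ℝ => Real.exp (-x)) (Ioi 0) := by
  simpa [pk] using integrableOn_pk (i := 0) one_pos

lemma wgt_eq {m z x : ℝ} (hz : 0 < z) (hx : 0 < x) (i : ℕ) :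
    wgt m z i x = poch m i / (i.factorial : ℝ) * z ^ i *
      (x ^ m * (1 / (x + z)) ^ (m + i)) := by
  rw [wgt, Real.div_rpow zero_le_one (by positivity), Real.one_rpow]
  ring

lemma integral_exp_mul_wgt {m z : ℝ} (hm : 0 < m) (hz : 0 < z) (i : ℕ) :
    ∫ x in Ioi (0 : ℝ), Real.exp (-x) * wgt m z i x =
      poch m i / (i.factorial : ℝ) * z ^ i * (Real.Gamma (m + 1) * kummerU (m + i) i z) := by
  set D := poch m i / (i.factorial : ℝ) * z ^ i with hD
  have hDpos : 0 < D := by have := poch_pos hm i; positivity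
  have hmi : 0 < m + i := by positivity
  have hG := Real.Gamma_pos_of_pos hmi
  set f : ℝ → ℝ → ℝ := fun x t =>
    Real.exp (-x) * x ^ m * (t ^ (m + i - 1) * Real.exp (-((x + z) * t))) with hf
  have hft : ∀ x ∈ Ioi (0 : ℝ), ∫ t in Ioi (0 : ℝ), f x t =
      Real.Gamma (m + i) / D * (Real.exp (-x) * wgt m z i x) := by
    intro x hx
    have hx' : 0 < x := hx
    simp only [hf]
    rw [integral_const_mul, Real.integral_rpow_mul_exp_neg_mul_Ioi hmi (by positivity),
      wgt_eq hz hx', ← hD]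
    field_simp
  have hfx : ∀ t ∈ Ioi (0 : ℝ), ∫ x in Ioi (0 : ℝ), f x t = Real.Gamma (m + 1) *
      (Real.exp (-z * t) * t ^ (m + i - 1) * (1 + t) ^ ((i : ℝ) - (m + i) - 1)) := by
    intro t ht
    have ht' : 0 < t := ht
    have h1 : ∀ x ∈ Ioi (0 : ℝ), f x t = (t ^ (m + i - 1) * Real.exp (-z * t)) *
        (x ^ (m + 1 - 1) * Real.exp (-((1 + t) * x))) := by
      intro x _
      have : Real.exp (-((1 + t) * x)) * Real.exp (-z * t) =
          Real.exp (-x) * Real.exp (-((x + z) * t)) := by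
        rw [← Real.exp_add, ← Real.exp_add]; ring_nf
      simp only [hf, add_sub_cancel_right]
      linear_combination (-(x ^ m * t ^ (m + i - 1))) * this
    rw [setIntegral_congr_fun measurableSet_Ioi h1, integral_const_mul,
      Real.integral_rpow_mul_exp_neg_mul_Ioi (by positivity) (by positivity), one_div,
      Real.inv_rpow (by positivity), ← Real.rpow_neg (by positivity)]
    have : -(m + 1) = (i : ℝ) - (m + i) - 1 := by ring
    rw [this]
    ring
  have hfnn : ∀ x ∈ Ioi (0 : ℝ), ∀ t ∈ Ioi (0 : ℝ), 0 ≤ f x t := by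
    intro x hx t ht
    have hx' : 0 < x := hx
    have ht' : 0 < t := ht
    simp only [hf]; positivity
  have hfint : Integrable (Function.uncurry f)
      ((volume.restrict (Ioi (0 : ℝ))).prod (volume.restrict (Ioi (0 : ℝ)))) := by
    have hmeas : Measurable (Function.uncurry f) := by
      simp only [hf, Function.uncurry_def]; fun_prop
    rw [integrable_prod_iff hmeas.aestronglyMeasurable]
    constructor
    · refine (ae_restrict_iff' measurableSet_Ioi).2 (Filter.Eventually.of_forall fun x hx => ?_)
      have hx' : 0 < x := hx
      exact (integrableOn_rpow_mul_exp (r := x + z) hmi (by positivity)).const_mul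
        (Real.exp (-x) * x ^ m)
    · have h0 := (integrable_mul_wgt hm hz integrableOn_exp_neg_pk i).const_mul
        (Real.Gamma (m + i) / D)
      refine IntegrableOn.congr_fun h0 (fun x hx => ?_) measurableSet_Ioi
      rw [← hft x hx]
      refine setIntegral_congr_fun measurableSet_Ioi fun t ht => ?_
      exact (Real.norm_of_nonneg (hfnn x hx t ht)).symm
  have hswap := integral_integral_swap hfint
  rw [setIntegral_congr_fun measurableSet_Ioi hft, setIntegral_congr_fun measurableSet_Ioi hfx,
    integral_const_mul, integral_const_mul] at hswap
  rw [kummerU]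
  field_simp at hswap ⊢
  linear_combination hswap

/-! ### The conditional density as a mixture -/

lemma condPdf_eq {m k γb x γ : ℝ} (hm : 0 < m) (hk : 0 < k) (hγb : 0 < γb) (hx : 0 < x) :
    condPdf m k γb x γ * Real.exp (-x) =
      ∑' i, Real.exp (-x) * wgt m (k / m) i x * pk i ((k + 1) / γb / x) γ := by
  rw [condPdf, kummerM, ← tsum_mul_left, ← tsum_mul_right]
  refine tsum_congr fun i => ?_
  have hxz : 0 < x + k / m := by positivity
  have e1 : (1 + k / x) / ((k + x) / (k + 1) * γb) = (k + 1) / γb / x := by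
    field_simp
    ring
  have e2 : m + k / x = m * (x + k / m) / x := by field_simp
  have e3 : (k / x) * (1 + k / x) / (k / x + m) * (γ / ((k + x) / (k + 1) * γb)) =
      (k / m) / (x + k / m) * ((k + 1) / γb / x) * γ := by
    rw [← e1, add_comm (k / x) m, e2]
    field_simp
  have e4 : (m ^ m * (1 + k / x)) / ((m + k / x) ^ m * ((k + x) / (k + 1) * γb)) =
      x ^ m / (x + k / m) ^ m * ((k + 1) / γb / x) := by
    rw [← e1, e2, Real.div_rpow (by positivity) hx.le, Real.mul_rpow hm.le hxz.le]
    have h1 : 0 < m ^ m := by positivity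
    have h2 : 0 < x ^ m := by positivity
    have h3 : 0 < (x + k / m) ^ m := by positivity
    generalize (x + k / m) ^ m = X at *
    generalize x ^ m = Y at *
    generalize m ^ m = Z at *
    field_simp
  rw [e4, e3, e1, wgt, pk, Real.rpow_add hxz, Real.rpow_natCast]
  generalize (k + 1) / γb / x = r
  have h3 : 0 < (x + k / m) ^ m := by positivity
  rw [neg_mul, mul_pow, mul_pow, div_pow (k / m), pow_succ r]
  generalize (x + k / m) ^ m = X at *
  generalize x + k / m = Y at *
  field_simp

/-! ### Fubini -/

/-- The general term of the expansion of the integrand. -/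
noncomputable def trm (m z c a : ℝ) (i : ℕ) (p : ℝ × ℝ) : ℝ :=
  Real.log (p.1 / a) * (Real.exp (-p.2) * wgt m z i p.2 * pk i (c / p.2) p.1)

lemma measurable_trm (m z c a : ℝ) (i : ℕ) : Measurable (trm m z c a i) := by
  unfold trm wgt pk; fun_prop

/-- Majorant of the inner integral. -/
noncomputable def maj (m z c a : ℝ) (i : ℕ) (x : ℝ) : ℝ :=
  (Real.exp (-x) * (x / c + 2 * ((c / x) ^ (1 / 2 : ℝ) * Real.Gamma (1 / 2)) + |Real.log a|)) *
    wgt m z i x + (1 / c) * (Real.exp (-x) * (x * (i * wgt m z i x)))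

lemma integrableOn_maj_aux {c : ℝ} (a : ℝ) (hc : 0 < c) :
    IntegrableOn (fun x => Real.exp (-x) *
      (x / c + 2 * ((c / x) ^ (1 / 2 : ℝ) * Real.Gamma (1 / 2)) + |Real.log a|)) (Ioi 0) := by
  have h1 := (integrableOn_rpow_mul_pk (i := 0) (r := 1) (s := 1) one_pos
    (by norm_num)).const_mul (1 / c)
  have h2 := (integrableOn_rpow_mul_pk (i := 0) (r := 1) (s := -(1 / 2)) one_pos
    (by norm_num)).const_mul (2 * c ^ (1 / 2 : ℝ) * Real.Gamma (1 / 2))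
  have h3 := (integrableOn_exp_neg_pk).const_mul |Real.log a|
  refine IntegrableOn.congr_fun ((h1.add h2).add h3) (fun x hx => ?_) measurableSet_Ioi
  have hx' : 0 < x := hx
  simp only [Pi.add_apply, pk, Real.rpow_one, Real.div_rpow hc.le hx'.le, Real.rpow_neg hx'.le]
  simp
  ring

lemma maj_second_succ {m z c x : ℝ} (hx : 0 < x) (i : ℕ) :
    (1 / c) * (Real.exp (-x) * (x * ((i + 1 : ℕ) * wgt m z (i + 1) x))) =
      (m * z / c) * (Real.exp (-x) * wgt (m + 1) z i x) := by
  rw [mul_wgt_succ hx]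
  ring

lemma integrableOn_maj_second {m z c : ℝ} (hm : 0 < m) (hz : 0 < z) (i : ℕ) :
    IntegrableOn (fun x => (1 / c) * (Real.exp (-x) * (x * (i * wgt m z i x)))) (Ioi 0) := by
  cases i with
  | zero => simp
  | succ i =>
    refine IntegrableOn.congr_fun ((integrable_mul_wgt (m := m + 1) (by positivity) hz
      integrableOn_exp_neg_pk i).const_mul (m * z / c)) (fun x hx => ?_) measurableSet_Ioi
    exact (maj_second_succ hx i).symm

lemma integrableOn_maj {m z c : ℝ} (a : ℝ) (hm : 0 < m) (hz : 0 < z) (hc : 0 < c) (i : ℕ) :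
    IntegrableOn (maj m z c a i) (Ioi 0) :=
  Integrable.add (integrable_mul_wgt hm hz (integrableOn_maj_aux a hc) i)
    (integrableOn_maj_second hm hz i)

lemma summable_integral_maj {m z c : ℝ} (a : ℝ) (hm : 0 < m) (hz : 0 < z) (hc : 0 < c) :
    Summable fun i => ∫ x in Ioi (0 : ℝ), maj m z c a i x := by
  have h1 := (hasSum_integral_mul_wgt hm hz (integrableOn_maj_aux a hc)).summable
  have h2 : Summable fun i : ℕ =>
      ∫ x in Ioi (0 : ℝ), (1 / c) * (Real.exp (-x) * (x * (i * wgt m z i x))) := by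
    rw [← summable_nat_add_iff 1]
    refine ((hasSum_integral_mul_wgt (m := m + 1) (by positivity) hz
      integrableOn_exp_neg_pk).summable.mul_left (m * z / c)).congr fun i => ?_
    rw [← integral_const_mul]
    refine setIntegral_congr_fun measurableSet_Ioi fun x hx => ?_
    exact (maj_second_succ hx i).symm
  refine (h1.add h2).congr fun i => ?_
  rw [← integral_add (integrable_mul_wgt hm hz (integrableOn_maj_aux a hc) i)
    (integrableOn_maj_second hm hz i)]
  rfl

lemma norm_trm {m z c a γ x : ℝ} (hm : 0 < m) (hz : 0 < z) (hc : 0 < c) (hx : 0 < x)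
    (hγ : 0 < γ) (i : ℕ) :
    ‖trm m z c a i (γ, x)‖ =
      (Real.exp (-x) * wgt m z i x) * (|Real.log (γ / a)| * pk i (c / x) γ) := by
  have h1 : 0 ≤ Real.exp (-x) * wgt m z i x * pk i (c / x) γ :=
    mul_nonneg (mul_nonneg (Real.exp_pos _).le (wgt_nonneg hm hz hx i))
      (pk_nonneg (by positivity) hγ)
  rw [trm, norm_mul, Real.norm_of_nonneg h1, Real.norm_eq_abs]
  ring

lemma integral_norm_trm_le {m z c a x : ℝ} (hm : 0 < m) (hz : 0 < z) (hc : 0 < c) (ha : 0 < a)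
    (hx : 0 < x) (i : ℕ) :
    ∫ γ in Ioi (0 : ℝ), ‖trm m z c a i (γ, x)‖ ≤ maj m z c a i x := by
  rw [setIntegral_congr_fun measurableSet_Ioi fun γ hγ => norm_trm hm hz hc hx hγ i,
    integral_const_mul]
  have h1 : 0 ≤ Real.exp (-x) * wgt m z i x :=
    mul_nonneg (Real.exp_pos _).le (wgt_nonneg hm hz hx i)
  refine (mul_le_mul_of_nonneg_left (integral_abs_log_mul_pk_le (div_pos hc hx) ha) h1).trans
    (le_of_eq ?_)
  rw [maj]
  field_simp
  ring

lemma integrable_trm {m z c a : ℝ} (hm : 0 < m) (hz : 0 < z) (hc : 0 < c) (ha : 0 < a)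
    (i : ℕ) :
    Integrable (trm m z c a i)
      ((volume.restrict (Ioi (0 : ℝ))).prod (volume.restrict (Ioi (0 : ℝ)))) := by
  have hmeas := (measurable_trm m z c a i).aestronglyMeasurable
    (μ := (volume.restrict (Ioi (0 : ℝ))).prod (volume.restrict (Ioi (0 : ℝ))))
  rw [integrable_prod_iff' hmeas]
  constructor
  · refine (ae_restrict_iff' measurableSet_Ioi).2 (Filter.Eventually.of_forall fun x hx => ?_)
    refine ((integrableOn_log_mul_pk (i := i) (div_pos hc hx) ha).const_mul
      (Real.exp (-x) * wgt m z i x)).congr (Filter.Eventually.of_forall fun γ => ?_)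
    simp only [trm]
    ring
  · refine Integrable.mono' (integrableOn_maj a hm hz hc i)
      hmeas.norm.prod_swap.integral_prod_right' ?_
    refine (ae_restrict_iff' measurableSet_Ioi).2 (Filter.Eventually.of_forall fun x hx => ?_)
    rw [Real.norm_of_nonneg (integral_nonneg fun γ => norm_nonneg _)]
    exact integral_norm_trm_le hm hz hc ha hx i

lemma summable_integral_norm_trm {m z c a : ℝ} (hm : 0 < m) (hz : 0 < z) (hc : 0 < c)
    (ha : 0 < a) :
    Summable fun i => ∫ p, ‖trm m z c a i p‖
      ∂((volume.restrict (Ioi (0 : ℝ))).prod (volume.restrict (Ioi (0 : ℝ)))) := by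
  refine Summable.of_nonneg_of_le (fun i => integral_nonneg fun p => norm_nonneg _)
    (fun i => ?_) (summable_integral_maj a hm hz hc)
  have hi := integrable_trm hm hz hc ha i
  rw [integral_prod_symm _ hi.norm]
  exact setIntegral_mono_on hi.norm.integral_prod_right (integrableOn_maj a hm hz hc i)
    measurableSet_Ioi fun x hx => integral_norm_trm_le hm hz hc ha hx i

lemma integral_trm {m z c a : ℝ} (hm : 0 < m) (hz : 0 < z) (hc : 0 < c) (ha : 0 < a) (i : ℕ) :
    ∫ p, trm m z c a i p
      ∂((volume.restrict (Ioi (0 : ℝ))).prod (volume.restrict (Ioi (0 : ℝ)))) =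
      (harmonicR i - Real.eulerMascheroniConstant) *
        (∫ x in Ioi (0 : ℝ), Real.exp (-x) * wgt m z i x) +
      ∫ x in Ioi (0 : ℝ), (Real.log (x / (c * a)) * pk 0 1 x) * wgt m z i x := by
  rw [integral_prod_symm _ (integrable_trm hm hz hc ha i), ← integral_const_mul, ← integral_add
    ((integrable_mul_wgt hm hz integrableOn_exp_neg_pk i).const_mul _)
    (integrable_mul_wgt hm hz (integrableOn_log_mul_pk one_pos (by positivity)) i)]
  refine setIntegral_congr_fun measurableSet_Ioi fun x hx => ?_
  have hx' : 0 < x := hx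
  have h1 : ∀ γ, trm m z c a i (γ, x) =
      (Real.exp (-x) * wgt m z i x) * (Real.log (γ / a) * pk i (c / x) γ) := fun γ => by
    simp only [trm]; ring
  simp only [h1]
  rw [integral_const_mul, integral_log_mul_pk (div_pos hc hx') ha,
    Real.log_div hx'.ne' (by positivity), Real.log_mul hc.ne' ha.ne',
    Real.log_div hc.ne' hx'.ne']
  simp [pk]
  ring

theorem opra_nat_log (m k γb γ₀ : ℝ) (hm : 0 < m) (hγb : 0 < γb)
    (hγ₀ : 0 < γ₀) (hk : 0 < k) :
    HasSum (fun i : ℕ => Real.Gamma (m + 1) * (poch m i / (Nat.factorial i : ℝ) * (k / m) ^ i *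
            (harmonicR i - Real.eulerMascheroniConstant) * kummerU (m + i) i (k / m)))
      ((∫ γ in Ioi (0 : ℝ), Real.log (γ / γ₀) * pdfSNR m k γb γ) -
        (Real.log (γb / (γ₀ * (k + 1))) - Real.eulerMascheroniConstant)) := by
  set z := k / m with hzdef
  have hz : 0 < z := by positivity
  set c := (k + 1) / γb with hcdef
  have hc : 0 < c := by positivity
  have hI := integrable_trm (a := γ₀) hm hz hc hγ₀
  have hS := summable_integral_norm_trm (a := γ₀) hm hz hc hγ₀
  have h1 := hasSum_integral_of_summable_integral_norm hI hS
  rw [integral_prod _ (integrable_tsum_of_summable hI hS)] at h1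
  have h2 : (∫ γ in Ioi (0 : ℝ), ∫ x in Ioi (0 : ℝ), ∑' i, trm m z c γ₀ i (γ, x)) =
      ∫ γ in Ioi (0 : ℝ), Real.log (γ / γ₀) * pdfSNR m k γb γ := by
    refine setIntegral_congr_fun measurableSet_Ioi fun γ hγ => ?_
    simp only [pdfSNR]
    rw [← integral_const_mul]
    refine setIntegral_congr_fun measurableSet_Ioi fun x hx => ?_
    simp only [trm]
    rw [tsum_mul_left, condPdf_eq hm hk hγb hx]
  rw [h2] at h1
  have hca : 0 < c * γ₀ := by positivity
  have h3 := hasSum_integral_mul_wgt hm hz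
    (integrableOn_log_mul_pk (i := 0) (r := 1) (a := c * γ₀) one_pos hca)
  rw [integral_log_mul_pk one_pos hca] at h3
  have h4 := h1.sub h3
  have e : harmonicR 0 - Real.eulerMascheroniConstant - Real.log 1 - Real.log (c * γ₀) =
      Real.log (γb / (γ₀ * (k + 1))) - Real.eulerMascheroniConstant := by
    have : γb / (γ₀ * (k + 1)) = (c * γ₀)⁻¹ := by rw [hcdef]; field_simp
    rw [this, Real.log_inv]
    simp [harmonicR]
    ring
  rw [e] at h4
  have h5 : (fun i : ℕ => Real.Gamma (m + 1) * (poch m i / (Nat.factorial i : ℝ) * z ^ i *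
      (harmonicR i - Real.eulerMascheroniConstant) * kummerU (m + i) i z)) = fun i : ℕ =>
      (∫ p, trm m z c γ₀ i p
        ∂((volume.restrict (Ioi (0 : ℝ))).prod (volume.restrict (Ioi (0 : ℝ))))) -
      ∫ x in Ioi (0 : ℝ), (Real.log (x / (c * γ₀)) * pk 0 1 x) * wgt m z i x := by
    ext i
    rw [integral_trm hm hz hc hγ₀, integral_exp_mul_wgt hm hz]
    ring
  rw [h5]
  exact h4

/-- Theorem 6: high-SNR OPRA capacity in closed form. For `m > 0`, `γ̄ > 0`, `γ₀ > 0`,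
`0 < k < m`:
`∫₀^∞ log₂(γ/γ₀) f(γ) dγ = log₂(γ̄/(γ₀(k+1))) − γ_E/ln 2
  + (Γ(m+1)/ln 2) ∑_i ((m)_i/i!) (k/m)^i (H_i − γ_E) U(m+i, i, k/m)`. -/
theorem opra_highSNR_closed_form (m k γb γ₀ : ℝ) (hm : 0 < m) (hγb : 0 < γb)
    (hγ₀ : 0 < γ₀) (hk : 0 < k) (hkm : k < m) :
    ∫ γ in Ioi (0 : ℝ), Real.logb 2 (γ / γ₀) * pdfSNR m k γb γ =
      Real.logb 2 (γb / (γ₀ * (k + 1))) - Real.eulerMascheroniConstant / Real.log 2 +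
        (Real.Gamma (m + 1) / Real.log 2) *
          ∑' i : ℕ, poch m i / (Nat.factorial i : ℝ) * (k / m) ^ i *
            (harmonicR i - Real.eulerMascheroniConstant) * kummerU (m + i) i (k / m) := by
  have h := (opra_nat_log m k γb γ₀ hm hγb hγ₀ hk).tsum_eq
  rw [tsum_mul_left] at h
  have h2 : 0 < Real.log 2 := Real.log_pos (by norm_num)
  have h3 : ∀ γ, Real.logb 2 (γ / γ₀) * pdfSNR m k γb γ =
      (1 / Real.log 2) * (Real.log (γ / γ₀) * pdfSNR m k γb γ) := fun γ => by
    rw [Real.logb]; ring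
  simp only [h3]
  rw [integral_const_mul, Real.logb]
  linear_combination (-(1 / Real.log 2)) * h
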